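/- arXiv:1602.05876 — 6 statements merged into one kernel-verified Lean document; each statement's English description precedes it below -/
import Mathlib

section
/- Let n ≥ 0 and let A be an invertible (n+1)×(n+1) matrix with rational entries. Suppose q ∈ ℚ^{n+1} and d ∈ ℚ with d ≠ 0 satisfy A *ᵥ q = d • 𝟙 and Σ_i q_i = d. If r ∈ ℚ^{n+1} and e ∈ ℚ with e ≠ 0 satisfy Aᵀ *ᵥ r = e • 𝟙, then Σ_i r_i = e. (In other words, if the hypersurface defined by F_A is Calabi–Yau, then the hypersurface defined by the transposed polynomial F_{Aᵀ} is Calabi–Yau.) -/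
open Matrix Finset

/-- If the hypersurface defined by `F_A` is Calabi–Yau (`A *ᵥ q = d • 𝟙` and `∑ q i = d`),
then the hypersurface defined by the transposed polynomial is Calabi–Yau: any weights `r`
and degree `e ≠ 0` with `Aᵀ *ᵥ r = e • 𝟙` satisfy `∑ r i = e`. -/
theorem transpose_calabiYau_of_calabiYau
    (n : ℕ) (A : Matrix (Fin (n + 1)) (Fin (n + 1)) ℚ) (hA : IsUnit A)
    (q : Fin (n + 1) → ℚ) (d : ℚ) (hd : d ≠ 0)
    (hq : A *ᵥ q = d • (1 : Fin (n + 1) → ℚ)) (hCY : ∑ i, q i = d)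
    (r : Fin (n + 1) → ℚ) (e : ℚ) (he : e ≠ 0)
    (hr : Aᵀ *ᵥ r = e • (1 : Fin (n + 1) → ℚ)) :
    ∑ i, r i = e := by
  have h : r ⬝ᵥ (A *ᵥ q) = (Aᵀ *ᵥ r) ⬝ᵥ q := by
    rw [dotProduct_mulVec, mulVec_transpose]
  rw [hq, hr, dotProduct_smul, smul_dotProduct, dotProduct_one, one_dotProduct, hCY,
    smul_eq_mul, smul_eq_mul, mul_comm e] at h
  exact mul_left_cancel₀ hd h
end

section
/- Let n ≥ 0 and let A be an (n+1)×(n+1) matrix of integers with det A ≠ 0. Then the group G_A := {λ ∈ (ℂˣ)^{n+1} : ∀ i, ∏_{j=0}^n λ_j^{A_{ij}} = 1} (integer exponents interpreted via zpow) has exactly |det A| elements. -/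
open Finset

/-- The `ℤ`-span of the rows of an integer matrix. -/
abbrev Matrix.rowLattice {ι κ : Type*} (A : Matrix ι κ ℤ) : Submodule ℤ (κ → ℤ) :=
  Submodule.span ℤ (Set.range A.row)

/-- The row lattice of a nonsingular integer matrix has index `|det A|`. -/
theorem Matrix.card_quotient_rowLattice {ι : Type*} [Fintype ι] [DecidableEq ι]
    (A : Matrix ι ι ℤ) (hA : A.det ≠ 0) :
    Nat.card ((ι → ℤ) ⧸ A.rowLattice) = A.det.natAbs := by
  have hli : LinearIndependent ℤ A.row := Matrix.linearIndependent_rows_of_det_ne_zero hA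
  have h : (fun i ↦ (Module.Basis.span hli i : ι → ℤ)) = A.row :=
    funext fun i ↦ congrArg Subtype.val (Module.Basis.span_apply hli i)
  calc
    _ = ((Pi.basisFun ℤ ι).det fun i ↦ (Module.Basis.span hli i : ι → ℤ)).natAbs :=
      (Submodule.natAbs_det_basis_change (Pi.basisFun ℤ ι) A.rowLattice
        (Module.Basis.span hli)).symm
    _ = A.det.natAbs := by
      rw [h, Pi.basisFun_det_apply]
      rfl

/-- Solutions in a commutative group of the monomial equations given by an integer matrix
correspond to characters of the quotient by its row lattice. -/
theorem Matrix.ncard_monomial_solutions {ι κ H : Type*} [Fintype κ] [DecidableEq κ]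
    [CommGroup H] (A : Matrix ι κ ℤ) :
    {x : κ → H | ∀ i, ∏ j, x j ^ A i j = 1}.ncard =
      Nat.card (Multiplicative ((κ → ℤ) ⧸ A.rowLattice) →* H) := by
  let c : (κ → Additive H) ≃ₗ[ℤ] ((κ → ℤ) →ₗ[ℤ] Additive H) := (Pi.basisFun ℤ κ).constr ℤ
  have hc (x : κ → H) (v : κ → ℤ) :
      c (fun j ↦ Additive.ofMul (x j)) v = Additive.ofMul (∏ j, x j ^ v j) := by
    simp [c, Module.Basis.constr_apply_fintype, ofMul_prod]
  have hker (x : κ → H) : (∀ i, ∏ j, x j ^ A i j = 1) ↔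
      A.rowLattice ≤ LinearMap.ker (c fun j ↦ Additive.ofMul (x j)) := by
    rw [Matrix.rowLattice, Submodule.span_le, Set.range_subset_iff]
    refine forall_congr' fun i ↦ ?_
    rw [SetLike.mem_coe, LinearMap.mem_ker, hc, ofMul_eq_zero]
    rfl
  let r (f : Multiplicative ((κ → ℤ) ⧸ A.rowLattice) →* H) (j : κ) : H :=
    f (.ofAdd (A.rowLattice.mkQ (Pi.single j 1)))
  have hr (f) : c (fun j ↦ Additive.ofMul (r f j)) =
      (MonoidHom.toAdditiveRight f).toIntLinearMap ∘ₗ A.rowLattice.mkQ := by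
    refine (Pi.basisFun ℤ κ).ext fun j ↦ ?_
    rw [Module.Basis.constr_basis, Pi.basisFun_apply]
    rfl
  have hmem (f) : ∀ i, ∏ j, r f j ^ A i j = 1 := by
    rw [hker, hr]
    intro v hv
    have : A.rowLattice.mkQ v = 0 := by simpa using hv
    rw [LinearMap.mem_ker, LinearMap.comp_apply, this, map_zero]
  refine (Nat.card_congr (Equiv.ofBijective (fun f ↦ (⟨r f, hmem f⟩ :
    {x : κ → H | ∀ i, ∏ j, x j ^ A i j = 1})) ⟨?_, ?_⟩)).symm
  · intro f g hfg
    have h : r f = r g := congrArg Subtype.val hfg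
    have h' : (MonoidHom.toAdditiveRight f).toIntLinearMap ∘ₗ A.rowLattice.mkQ =
        (MonoidHom.toAdditiveRight g).toIntLinearMap ∘ₗ A.rowLattice.mkQ := by
      rw [← hr f, ← hr g, h]
    refine MonoidHom.ext fun q ↦ ?_
    obtain ⟨v, hv⟩ := A.rowLattice.mkQ_surjective q.toAdd
    have := LinearMap.congr_fun h' v
    rw [LinearMap.comp_apply, LinearMap.comp_apply, hv] at this
    exact this
  · rintro ⟨x, hx⟩
    refine ⟨AddMonoidHom.toMultiplicativeLeft
      (A.rowLattice.liftQ _ ((hker x).1 hx)).toAddMonoidHom, Subtype.ext (funext fun j ↦ ?_)⟩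
    change (c (fun j ↦ Additive.ofMul (x j)) (Pi.single j 1)).toMul = x j
    rw [← Pi.basisFun_apply, Module.Basis.constr_basis]
    rfl

/-- For an integer matrix `A` with `det A ≠ 0`, the group of diagonal symmetries
`G_A = {λ ∈ (ℂˣ)^{n+1} : ∀ i, ∏ j λ j ^ A i j = 1}` has exactly `|det A|` elements. -/
theorem card_diagonal_symmetry_group
    (n : ℕ) (A : Matrix (Fin (n + 1)) (Fin (n + 1)) ℤ) (hA : A.det ≠ 0) :
    {lam : Fin (n + 1) → ℂˣ | ∀ i, ∏ j, (lam j) ^ A i j = 1}.ncard = A.det.natAbs := by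
  have hcard := A.card_quotient_rowLattice hA
  have : Finite ((Fin (n + 1) → ℤ) ⧸ A.rowLattice) :=
    Nat.finite_of_card_ne_zero (hcard ▸ Int.natAbs_ne_zero.2 hA)
  rw [A.ncard_monomial_solutions, ← hcard]
  have : NeZero (Monoid.exponent (Multiplicative ((Fin (n + 1) → ℤ) ⧸ A.rowLattice))) :=
    ⟨Monoid.exponent_ne_zero_of_finite⟩
  exact CommGroup.card_monoidHom_of_hasEnoughRootsOfUnity _ ℂ
end

section
/- Let n ≥ 0 and let A be an (n+1)×(n+1) matrix of integers with det A ≠ 0. For 0 ≤ j ≤ n define ρ_j ∈ (ℂˣ)^{n+1} by (ρ_j)_i := exp(2π√(-1)·(A⁻¹)_{ij}), where A⁻¹ is the inverse of A over ℚ (so ρ_j exponentiates the j-th column of A⁻¹). Then the group G_A := {λ ∈ (ℂˣ)^{n+1} : ∀ i, ∏_{j=0}^n λ_j^{A_{ij}} = 1} (integer exponents interpreted via zpow) equals the subgroup of (ℂˣ)^{n+1} generated by ρ_0, …, ρ_n. -/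
open Finset

/-- The homomorphism `z ↦ exp (2π√(-1)·z)` from the additive group `ℂ` to `ℂˣ`. -/
noncomputable def expTwoPiIUnits : Multiplicative ℂ →* ℂˣ where
  toFun z := Units.mk0 (Complex.exp (2 * Real.pi * Complex.I * z.toAdd)) (Complex.exp_ne_zero _)
  map_one' := by ext; simp
  map_mul' z w := by ext; simp [mul_add, Complex.exp_add]

theorem expTwoPiIUnits_eq_one_iff (z : ℂ) :
    expTwoPiIUnits (.ofAdd z) = 1 ↔ ∃ m : ℤ, z = m := by
  have h : expTwoPiIUnits (.ofAdd z) = 1 ↔ Complex.exp (2 * Real.pi * Complex.I * z) = 1 :=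
    Units.ext_iff
  rw [h, Complex.exp_eq_one_iff]
  refine exists_congr fun m => ?_
  rw [mul_comm (m : ℂ), mul_right_inj' Complex.two_pi_I_ne_zero]

theorem expTwoPiIUnits_surjective (u : ℂˣ) : ∃ z : ℂ, expTwoPiIUnits (.ofAdd z) = u := by
  refine ⟨Complex.log u / (2 * Real.pi * Complex.I), Units.ext ?_⟩
  change Complex.exp (2 * Real.pi * Complex.I * (_ / _)) = u
  rw [mul_div_cancel₀ _ Complex.two_pi_I_ne_zero, Complex.exp_log u.ne_zero]

theorem prod_expTwoPiIUnits_zpow {ι : Type*} [Fintype ι] (z : ι → ℂ) (m : ι → ℤ) :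
    ∏ j, expTwoPiIUnits (.ofAdd (z j)) ^ m j = expTwoPiIUnits (.ofAdd (∑ j, m j * z j)) := by
  simp only [ofAdd_sum, map_prod, ← map_zpow, ← ofAdd_zsmul, zsmul_eq_mul]

/-- The diagonal symmetry group of an integer matrix `A`. -/
def diagonalSymmetryGroup {ι : Type*} [Fintype ι] (A : Matrix ι ι ℤ) : Subgroup (ι → ℂˣ) where
  carrier := {lam | ∀ i, ∏ j, lam j ^ A i j = 1}
  one_mem' i := by simp
  mul_mem' ha hb i := by simp [mul_zpow, Finset.prod_mul_distrib, ha i, hb i]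
  inv_mem' ha i := by simp [ha i]

theorem diagonalSymmetryGroup_eq_closure {ι : Type*} [Fintype ι] [DecidableEq ι]
    (A : Matrix ι ι ℤ) (B : Matrix ι ι ℂ) (hAB : A.map ((↑) : ℤ → ℂ) * B = 1) :
    diagonalSymmetryGroup A =
      Subgroup.closure (Set.range fun j i => expTwoPiIUnits (.ofAdd (B i j))) := by
  apply le_antisymm
  · intro lam hlam
    choose z hz using fun i => expTwoPiIUnits_surjective (lam i)
    have hm (i : ι) : ∃ m : ℤ, ∑ j, (A i j : ℂ) * z j = m := by
      rw [← expTwoPiIUnits_eq_one_iff, ← prod_expTwoPiIUnits_zpow]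
      simpa only [hz] using hlam i
    choose m hm using hm
    have hzm : z = B.mulVec fun j => (m j : ℂ) := by
      rw [← funext hm]
      change z = B.mulVec ((A.map ((↑) : ℤ → ℂ)).mulVec z)
      rw [Matrix.mulVec_mulVec, mul_eq_one_comm.mp hAB, Matrix.one_mulVec]
    have hprod : lam = ∏ j, (fun i => expTwoPiIUnits (.ofAdd (B i j))) ^ m j := by
      ext1 i
      simp only [Finset.prod_apply, Pi.pow_apply, prod_expTwoPiIUnits_zpow]
      rw [← hz i, hzm]
      simp only [Matrix.mulVec, dotProduct, mul_comm]
    rw [hprod]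
    exact Subgroup.prod_mem _ fun j _ =>
      Subgroup.zpow_mem _ (Subgroup.subset_closure (Set.mem_range_self j)) _
  · rw [Subgroup.closure_le]
    rintro _ ⟨j, rfl⟩ i
    rw [prod_expTwoPiIUnits_zpow, expTwoPiIUnits_eq_one_iff]
    refine ⟨(1 : Matrix ι ι ℤ) i j, ?_⟩
    change (A.map ((↑) : ℤ → ℂ) * B) i j = _
    rw [hAB]
    simp [Matrix.one_apply]

/-- For an integer matrix `A` with `det A ≠ 0`, the group of diagonal symmetries
`G_A = {λ : ∀ i, ∏ j λ j ^ A i j = 1}` equals the subgroup of `(ℂˣ)^{n+1}` generated by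
the elements `ρ_j` with `(ρ_j)_i = exp(2π√(-1)·(A⁻¹)_{ij})`, `A⁻¹` computed over `ℚ`. -/
theorem diagonal_symmetry_group_eq_closure_rho
    (n : ℕ) (A : Matrix (Fin (n + 1)) (Fin (n + 1)) ℤ) (hA : A.det ≠ 0) :
    {lam : Fin (n + 1) → ℂˣ | ∀ i, ∏ j, (lam j) ^ A i j = 1} =
      (Subgroup.closure (Set.range (fun j : Fin (n + 1) => fun i : Fin (n + 1) =>
        Units.mk0
          (Complex.exp (2 * Real.pi * Complex.I *
            (((A.map ((↑) : ℤ → ℚ))⁻¹ i j : ℚ) : ℂ)))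
          (Complex.exp_ne_zero _))) : Set (Fin (n + 1) → ℂˣ)) := by
  have hdet : IsUnit (A.map ((↑) : ℤ → ℚ)).det := by
    rw [isUnit_iff_ne_zero]
    change ((Int.castRingHom ℚ).mapMatrix A).det ≠ 0
    rw [← RingHom.map_det]
    exact Int.cast_ne_zero.mpr hA
  have hAB : A.map ((↑) : ℤ → ℂ) * (A.map ((↑) : ℤ → ℚ))⁻¹.map ((↑) : ℚ → ℂ) = 1 := by
    have h := congrArg (Rat.castHom ℂ).mapMatrix (Matrix.mul_nonsing_inv _ hdet)
    rw [map_mul, map_one] at h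
    rw [← h]
    congr 1
  exact congrArg SetLike.coe (diagonalSymmetryGroup_eq_closure A _ hAB)
end

section
/- Let κ be a field of characteristic 0 and work in the polynomial ring R = κ[y_0, y_1, y_1', y_2, u]. Let c_0, c_1, c_2, c_3 ∈ κ with c_2 ≠ 0 and set w := c_0·y_0^3·u + c_1·y_1^3·(y_1')^2·u + c_2·y_1'·y_2^3·u + c_3·y_0·y_1·y_1'·y_2·u. Let J_p be the ideal of R generated by y_1·y_0, y_1·y_1', y_1·y_2, and let I_p be the ideal generated by y_1·y_0, y_1·y_1', y_1·y_2, u·y_2. Then I_p is contained in the radical of the ideal generated by J_p together with all partial derivatives of w with respect to y_0, y_1, y_1', y_2, u. -/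
open MvPolynomial Finset

/-- Explicit example: in `κ[y_0, y_1, y_1', y_2, u]` (variables `X 0, X 1, X 2, X 3, X 4`
respectively), with `w = c_0 y_0^3 u + c_1 y_1^3 (y_1')^2 u + c_2 y_1' y_2^3 u
+ c_3 y_0 y_1 y_1' y_2 u` and `c_2 ≠ 0`, the irrelevant ideal
`I_p = (y_1 y_0, y_1 y_1', y_1 y_2, u y_2)` is contained in the radical of the ideal
generated by `J_p = (y_1 y_0, y_1 y_1', y_1 y_2)` and all partial derivatives of `w`. -/
theorem example_irrelevant_subset_radical
    (κ : Type) [Field κ] [CharZero κ] (c₀ c₁ c₂ c₃ : κ) (hc₂ : c₂ ≠ 0) :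
    (Ideal.span {(X 1 * X 0 : MvPolynomial (Fin 5) κ), X 1 * X 2, X 1 * X 3, X 4 * X 3} :
        Ideal (MvPolynomial (Fin 5) κ)) ≤
      (Ideal.span {(X 1 * X 0 : MvPolynomial (Fin 5) κ), X 1 * X 2, X 1 * X 3} ⊔
        Ideal.span (Set.range fun v : Fin 5 =>
          MvPolynomial.pderiv v
            (C c₀ * X 0 ^ 3 * X 4 + C c₁ * X 1 ^ 3 * X 2 ^ 2 * X 4 +
              C c₂ * X 2 * X 3 ^ 3 * X 4 + C c₃ * X 0 * X 1 * X 2 * X 3 * X 4))).radical := by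
  rw [Ideal.span_le]
  set w : MvPolynomial (Fin 5) κ := C c₀ * X 0 ^ 3 * X 4 + C c₁ * X 1 ^ 3 * X 2 ^ 2 * X 4 +
    C c₂ * X 2 * X 3 ^ 3 * X 4 + C c₃ * X 0 * X 1 * X 2 * X 3 * X 4 with hw
  set J : Ideal (MvPolynomial (Fin 5) κ) := Ideal.span {X 1 * X 0, X 1 * X 2, X 1 * X 3}
  set D : Ideal (MvPolynomial (Fin 5) κ) :=
    Ideal.span (Set.range fun v : Fin 5 => pderiv v w)
  have h₀ : (X 1 * X 0 : MvPolynomial (Fin 5) κ) ∈ J ⊔ D :=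
    Ideal.mem_sup_left (Ideal.subset_span (by simp))
  have h₂ : (X 1 * X 2 : MvPolynomial (Fin 5) κ) ∈ J ⊔ D :=
    Ideal.mem_sup_left (Ideal.subset_span (by simp))
  have h₃ : (X 1 * X 3 : MvPolynomial (Fin 5) κ) ∈ J ⊔ D :=
    Ideal.mem_sup_left (Ideal.subset_span (by simp))
  have hmem : pderiv 2 w ∈ J ⊔ D := Ideal.mem_sup_right (Ideal.subset_span ⟨2, rfl⟩)
  have hderiv : pderiv 2 w = 2 * C c₁ * X 1 ^ 3 * X 2 * X 4 + C c₂ * X 3 ^ 3 * X 4 +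
      C c₃ * X 0 * X 1 * X 3 * X 4 := by
    simp [hw, pderiv_X, Derivation.leibniz, Derivation.leibniz_pow]
    ring
  have hC : (C c₂⁻¹ * C c₂ : MvPolynomial (Fin 5) κ) = 1 := by
    rw [← C_mul, inv_mul_cancel₀ hc₂, C_1]
  have hpow : (X 4 * X 3 : MvPolynomial (Fin 5) κ) ^ 3 ∈ J ⊔ D := by
    have key : (X 4 * X 3 : MvPolynomial (Fin 5) κ) ^ 3 =
        C c₂⁻¹ * X 4 ^ 2 * (pderiv 2 w - 2 * C c₁ * X 1 ^ 2 * X 4 * (X 1 * X 2) -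
          C c₃ * X 3 * X 4 * (X 1 * X 0)) := by
      rw [hderiv]
      linear_combination -(X 4 * X 3 : MvPolynomial (Fin 5) κ) ^ 3 * hC
    rw [key]
    exact Ideal.mul_mem_left _ _ (sub_mem (sub_mem hmem (Ideal.mul_mem_left _ _ h₂))
      (Ideal.mul_mem_left _ _ h₀))
  rintro p (rfl | rfl | rfl | rfl)
  exacts [Ideal.le_radical h₀, Ideal.le_radical h₂, Ideal.le_radical h₃, ⟨3, hpow⟩]
end

section
/- Let E be a finite affinely independent set of points in ℝ^N, and let m be a point of the affine span of E with m ∉ convexHull(E). Then convexHull(E ∪ {m}) = convexHull(E) ∪ ⋃ { convexHull((E \ {v}) ∪ {m}) : v ∈ E such that convexHull((E \ {v}) ∪ {m}) ∩ intrinsicInterior(convexHull(E)) = ∅ }. -/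
open Set

/-- Each vertex of an affinely independent set has a barycentric coordinate that extends
to the whole space. -/
theorem AffineIndependent.exists_affineMap_eq_one_eq_zero {V : Type*} [AddCommGroup V]
    [Module ℝ V] {E : Set V} (hE : AffineIndependent ℝ ((↑) : E → V)) {v : V} (hv : v ∈ E) :
    ∃ φ : V →ᵃ[ℝ] ℝ, φ v = 1 ∧ ∀ e ∈ E \ {v}, φ e = 0 := by
  obtain ⟨t, hEt, ht, htop⟩ := exists_subset_affineIndependent_affineSpan_eq_top hE
  let b : AffineBasis t ℝ V := ⟨(↑), ht, by simpa using htop⟩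
  refine ⟨b.coord ⟨v, hEt hv⟩, b.coord_apply_eq ⟨v, hEt hv⟩, fun e he => ?_⟩
  exact b.coord_apply_ne (i := ⟨v, hEt hv⟩) (j := ⟨e, hEt he.1⟩)
    fun h => he.2 (congrArg Subtype.val h).symm

/-- A point of the affine span of a finite set is a combination of its points with weights
summing to one. -/
theorem Finset.exists_weights_of_mem_affineSpan {V : Type*} [AddCommGroup V] [Module ℝ V]
    {s : Finset V} {x : V} (hx : x ∈ affineSpan ℝ (s : Set V)) :
    ∃ w : V → ℝ, ∑ e ∈ s, w e = 1 ∧ ∑ e ∈ s, w e • e = x := by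
  classical
  have hx' : x ∈ affineSpan ℝ (Set.range ((↑) : s → V)) := by simpa using hx
  obtain ⟨w, hw, rfl⟩ := eq_affineCombination_of_mem_affineSpan_of_fintype hx'
  refine ⟨fun e => if h : e ∈ s then w ⟨e, h⟩ else 0, ?_, ?_⟩
  · rw [← Finset.sum_coe_sort]
    simpa using hw
  · rw [← Finset.sum_coe_sort, Finset.affineCombination_eq_linear_combination _ _ _ hw]
    simp

/-- An affine function is compatible with combinations whose weights sum to one. -/
theorem AffineMap.map_sum_smul {V : Type*} [AddCommGroup V] [Module ℝ V] (φ : V →ᵃ[ℝ] ℝ)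
    {s : Finset V} {w : V → ℝ} (hw : ∑ e ∈ s, w e = 1) :
    φ (∑ e ∈ s, w e • e) = ∑ e ∈ s, w e * φ e := by
  have h := s.map_affineCombination (fun e => e) w hw φ
  rw [Finset.affineCombination_eq_linear_combination _ _ _ hw,
    Finset.affineCombination_eq_linear_combination _ _ _ hw] at h
  simpa using h

/-- From any point of a set, the segment to an intrinsic interior point can be prolonged
within the set. -/
theorem exists_lineMap_mem_of_mem_intrinsicInterior {V : Type*} [NormedAddCommGroup V]
    [NormedSpace ℝ V] {s : Set V} {x y : V} (hx : x ∈ s) (hy : y ∈ intrinsicInterior ℝ s) :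
    ∃ c : ℝ, 1 < c ∧ AffineMap.lineMap x y c ∈ s := by
  obtain ⟨y, hy', rfl⟩ := mem_intrinsicInterior.1 hy
  have hx' : x ∈ affineSpan ℝ s := subset_affineSpan ℝ s hx
  let g : ℝ → affineSpan ℝ s := fun c =>
    ⟨AffineMap.lineMap x (y : V) c, AffineMap.lineMap_mem c hx' y.2⟩
  have hg : Continuous g := AffineMap.lineMap_continuous.subtype_mk _
  have hg1 : g 1 = y := Subtype.ext (AffineMap.lineMap_apply_one x (y : V))
  have hev : ∀ᶠ c in nhds (1 : ℝ), AffineMap.lineMap x (y : V) c ∈ s :=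
    hg.continuousAt.eventually (by rw [hg1]; exact mem_interior_iff_mem_nhds.1 hy')
  obtain ⟨c, hc, hc1⟩ := ((hev.filter_mono nhdsWithin_le_nhds).and
    (self_mem_nhdsWithin : Ioi (1 : ℝ) ∈ nhdsWithin 1 (Ioi 1))).exists
  exact ⟨c, hc1, hc⟩

/-- An affine function that is nonnegative on a set and positive somewhere on it is positive
on the intrinsic interior. -/
theorem AffineMap.pos_of_mem_intrinsicInterior {V : Type*} [NormedAddCommGroup V]
    [NormedSpace ℝ V] {s : Set V} (φ : V →ᵃ[ℝ] ℝ) (hφ : ∀ x ∈ s, 0 ≤ φ x) {x y : V}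
    (hx : x ∈ s) (hφx : 0 < φ x) (hy : y ∈ intrinsicInterior ℝ s) : 0 < φ y := by
  obtain ⟨c, hc, hcs⟩ := exists_lineMap_mem_of_mem_intrinsicInterior hx hy
  have h := hφ _ hcs
  rw [AffineMap.apply_lineMap, AffineMap.lineMap_apply_ring'] at h
  by_contra! hle
  nlinarith

/-- If `φ` is the barycentric coordinate of the vertex `v` and `φ m ≤ 0`, then the facet
opposite to `v` is visible from `m`. -/
theorem convexHull_pyramid_inter_intrinsicInterior_eq_empty {V : Type*} [NormedAddCommGroup V]
    [NormedSpace ℝ V] {E : Set V} {v m : V} (hv : v ∈ E) (φ : V →ᵃ[ℝ] ℝ) (hφv : φ v = 1)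
    (hφ : ∀ e ∈ E \ {v}, φ e = 0) (hm : φ m ≤ 0) :
    convexHull ℝ ((E \ {v}) ∪ {m}) ∩ intrinsicInterior ℝ (convexHull ℝ E) = ∅ := by
  have hneg : convexHull ℝ ((E \ {v}) ∪ {m}) ⊆ φ ⁻¹' Iic 0 := by
    refine convexHull_min ?_ ((convex_Iic 0).affine_preimage φ)
    rintro e (he | rfl)
    · exact (hφ e he).le
    · exact hm
  have hnonneg : convexHull ℝ E ⊆ φ ⁻¹' Ici 0 := by
    refine convexHull_min (fun e he => ?_) ((convex_Ici 0).affine_preimage φ)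
    rcases eq_or_ne e v with rfl | hev
    · simp [hφv]
    · exact (hφ e ⟨he, hev⟩).ge
  refine eq_empty_of_forall_notMem fun y hy => not_lt_of_ge (show φ y ≤ 0 from hneg hy.1) ?_
  exact φ.pos_of_mem_intrinsicInterior (fun x hx => hnonneg hx)
    (subset_convexHull ℝ E hv) (hφv ▸ one_pos) hy.2

/-- A convex combination of `m` and a finite set `s`, where `m` is a combination of `s` with
weights `μ`, lies in the hull of `s` or in a pyramid with apex `m` over a facet opposite to a
vertex of negative weight. -/
theorem mem_convexHull_or_exists_mem_convexHull_pyramid {V : Type*} [AddCommGroup V]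
    [Module ℝ V] {s : Finset V} {μ : V → ℝ} (hμ : ∑ e ∈ s, μ e = 1) {x : V}
    (hx : x ∈ convexHull ℝ (insert (∑ e ∈ s, μ e • e) (s : Set V))) :
    x ∈ convexHull ℝ (s : Set V) ∨
      ∃ v ∈ s, μ v < 0 ∧ x ∈ convexHull ℝ (((s : Set V) \ {v}) ∪ {∑ e ∈ s, μ e • e}) := by
  classical
  set m := ∑ e ∈ s, μ e • e with hm
  have hs : s.Nonempty := Finset.nonempty_of_sum_ne_zero (hμ ▸ one_ne_zero)
  rw [convexHull_insert (Finset.coe_nonempty.2 hs), mem_convexJoin] at hx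
  obtain ⟨_, rfl, y, hy, t, r, ht, hr, htr, rfl⟩ := hx
  obtain ⟨w, hw, hw1, rfl⟩ := Finset.mem_convexHull'.1 hy
  have key : ∀ c : ℝ, t • m + r • ∑ e ∈ s, w e • e =
      (t - c) • m + ∑ e ∈ s, (r * w e + c * μ e) • e := by
    intro c
    simp only [add_smul, mul_smul, Finset.sum_add_distrib, ← Finset.smul_sum, ← hm, sub_smul]
    abel
  have hsum : ∀ c : ℝ, ∑ e ∈ s, (r * w e + c * μ e) = r + c := by
    intro c
    rw [Finset.sum_add_distrib, ← Finset.mul_sum, ← Finset.mul_sum, hw1, hμ, mul_one, mul_one]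
  by_cases hpos : ∀ e ∈ s, 0 ≤ r * w e + t * μ e
  · left
    rw [key t, sub_self, zero_smul, zero_add]
    exact Finset.mem_convexHull'.2 ⟨_, hpos, by rw [hsum]; linarith, rfl⟩
  right
  push Not at hpos
  obtain ⟨u, hu, hut⟩ := hpos
  have hμu : μ u < 0 := by
    by_contra! h
    nlinarith [mul_nonneg hr (hw u hu), mul_nonneg ht h]
  obtain ⟨v, hv, hmin⟩ := (s.filter (μ · < 0)).exists_min_image (fun e => r * w e / -μ e)
    ⟨u, Finset.mem_filter.2 ⟨hu, hμu⟩⟩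
  obtain ⟨hvs, hμv⟩ := Finset.mem_filter.1 hv
  set c := r * w v / -μ v with hc
  have hc0 : 0 ≤ c := div_nonneg (mul_nonneg hr (hw v hvs)) (by linarith)
  have hcv : r * w v + c * μ v = 0 := by
    rw [hc]
    field_simp [hμv.ne]
    ring
  have hct : c < t := by
    refine (hmin u (Finset.mem_filter.2 ⟨hu, hμu⟩)).trans_lt ?_
    rw [div_lt_iff₀ (by linarith)]
    linarith
  have hnonneg : ∀ e ∈ s, 0 ≤ r * w e + c * μ e := by
    intro e he
    rcases lt_or_ge (μ e) 0 with h | h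
    · have := hmin e (Finset.mem_filter.2 ⟨he, h⟩)
      rw [le_div_iff₀ (by linarith)] at this
      linarith
    · exact add_nonneg (mul_nonneg hr (hw e he)) (mul_nonneg hc0 h)
  refine ⟨v, hvs, hμv, ?_⟩
  have hcomb := (convex_convexHull ℝ (((s : Set V) \ {v}) ∪ {m})).sum_mem (t := s)
    (w := fun e => if e = v then t - c else r * w e + c * μ e)
    (z := fun e => if e = v then m else e) ?_ ?_ ?_
  · convert! hcomb using 1
    rw [key c, ← Finset.add_sum_erase s _ hvs, ← Finset.add_sum_erase s _ hvs, hcv, zero_smul,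
      zero_add, if_pos rfl, if_pos rfl]
    refine congrArg _ (Finset.sum_congr rfl fun e he => ?_)
    rw [if_neg (Finset.ne_of_mem_erase he), if_neg (Finset.ne_of_mem_erase he)]
  · intro e he
    split_ifs
    exacts [sub_nonneg.2 hct.le, hnonneg e he]
  · have h := hsum c
    rw [← Finset.add_sum_erase s _ hvs, hcv, zero_add] at h
    rw [← Finset.add_sum_erase s _ hvs, if_pos rfl, Finset.sum_congr rfl fun e he =>
      if_neg (Finset.ne_of_mem_erase he), h]
    linarith
  · intro e he
    refine subset_convexHull ℝ _ ?_
    split_ifs with hev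
    exacts [Or.inr rfl, Or.inl ⟨he, hev⟩]

/-- Covering step in the triangulation lemma: for a finite affinely independent set `E`
in `ℝ^N` and a point `m` of the affine span of `E` with `m ∉ convexHull E`, the convex
hull of `E ∪ {m}` is covered by the simplex `convexHull E` together with the pyramids
`convexHull ((E \ {v}) ∪ {m})` over the facets of the simplex visible from `m`. -/
theorem convexHull_insert_eq_union_visible_pyramids
    (N : ℕ) (E : Set (Fin N → ℝ)) (hfin : E.Finite)
    (hind : AffineIndependent ℝ ((↑) : E → (Fin N → ℝ)))
    (m : Fin N → ℝ) (hm : m ∈ affineSpan ℝ E) (hm' : m ∉ convexHull ℝ E) :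
    convexHull ℝ (E ∪ {m}) =
      convexHull ℝ E ∪
        ⋃ v ∈ {v ∈ E | convexHull ℝ ((E \ {v}) ∪ {m}) ∩
            intrinsicInterior ℝ (convexHull ℝ E) = ∅},
          convexHull ℝ ((E \ {v}) ∪ {m}) := by
  refine Subset.antisymm (fun x hx => ?_) (union_subset (convexHull_mono subset_union_left)
    (iUnion₂_subset fun v _ => convexHull_mono (union_subset_union_left _ sdiff_subset)))
  lift E to Finset (Fin N → ℝ) using hfin
  obtain ⟨μ, hμ, rfl⟩ := Finset.exists_weights_of_mem_affineSpan hm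
  rw [union_singleton] at hx
  refine (mem_convexHull_or_exists_mem_convexHull_pyramid hμ hx).imp_right ?_
  rintro ⟨v, hv, hμv, hxv⟩
  obtain ⟨φ, hφv, hφ⟩ := hind.exists_affineMap_eq_one_eq_zero hv
  have hφm : φ (∑ e ∈ E, μ e • e) = μ v := by
    rw [φ.map_sum_smul hμ, Finset.sum_eq_single_of_mem v hv, hφv, mul_one]
    intro e he hev
    rw [hφ e ⟨he, hev⟩, mul_zero]
  exact mem_iUnion₂.2 ⟨v, ⟨hv, convexHull_pyramid_inter_intrinsicInterior_eq_empty hv φ hφv hφ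
    (hφm.trans_lt hμv).le⟩, hxv⟩
end

section
/- Let E be a finite nonempty affinely independent set of points in ℝ^N, and let p ∈ convexHull(E). Then convexHull(E) = ⋃_{v ∈ E} convexHull((E \ {v}) ∪ {p}). -/
open Set

/-- A point of the convex hull of a finite set `s` stays in the convex hull when a suitable
point of `s` is replaced by any given point `p` of the convex hull of `s`. -/
theorem Finset.exists_mem_convexHull_diff_union_singleton {V : Type*} [AddCommGroup V]
    [Module ℝ V] {s : Finset V} {p x : V} (hp : p ∈ convexHull ℝ (s : Set V))
    (hx : x ∈ convexHull ℝ (s : Set V)) :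
    ∃ v ∈ s, x ∈ convexHull ℝ (((s : Set V) \ {v}) ∪ {p}) := by
  classical
  obtain ⟨b, hb0, hb1, hbp⟩ := Finset.mem_convexHull'.1 hp
  obtain ⟨a, ha0, ha1, hax⟩ := Finset.mem_convexHull'.1 hx
  have hpos : ∃ u ∈ s, 0 < b u := Finset.exists_lt_of_sum_lt (by simp [hb1])
  obtain ⟨v, hv, hmin⟩ := Finset.exists_min_image (s.filter fun u => 0 < b u)
    (fun u => a u / b u) (by simpa [Finset.Nonempty] using hpos)
  obtain ⟨hvs, hbv⟩ := Finset.mem_filter.1 hv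
  set t := a v / b v with ht
  have ht0 : 0 ≤ t := div_nonneg (ha0 v hvs) hbv.le
  have hc0 : ∀ u ∈ s, 0 ≤ a u - t * b u := by
    intro u hu
    rcases (hb0 u hu).eq_or_lt with h | h
    · simpa [← h] using ha0 u hu
    · exact sub_nonneg.2 ((le_div_iff₀ h).1 (hmin u (Finset.mem_filter.2 ⟨hu, h⟩)))
  have hcv : a v - t * b v = 0 := by rw [ht, div_mul_cancel₀ _ hbv.ne', sub_self]
  refine ⟨v, hvs, ?_⟩
  have hmem := (convex_convexHull ℝ (((s : Set V) \ {v}) ∪ {p})).sum_mem (t := s)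
    (w := fun u => (a u - t * b u) + if u = v then t else 0)
    (z := fun u => if u = v then p else u)
    (fun u hu => add_nonneg (hc0 u hu) (by split_ifs <;> simp [ht0]))
    (by simp [Finset.sum_add_distrib, Finset.sum_sub_distrib, ← Finset.mul_sum, ha1, hb1, hvs])
    (fun u hu => subset_convexHull ℝ _ (by
      by_cases h : u = v
      · simp [h]
      · simp [h, Finset.mem_coe.2 hu]))
  have hterm : ∀ u ∈ s, ((a u - t * b u) + if u = v then t else 0) • (if u = v then p else u) =
      (a u • u - t • b u • u) + if u = v then t • p else 0 := by
    intro u _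
    by_cases h : u = v
    · subst h
      simp only [if_true, hcv, zero_add, smul_smul, ← sub_smul, zero_smul]
    · simp [h, sub_smul, smul_smul]
  rw [Finset.sum_congr rfl hterm] at hmem
  simpa [Finset.sum_add_distrib, Finset.sum_sub_distrib, ← Finset.smul_sum, hax, hbp, hvs]
    using hmem

/-- Covering property of the stellar subdivision: for a finite nonempty affinely
independent set `E` in `ℝ^N` and a point `p ∈ convexHull E`, the simplex `convexHull E`
is the union of the pyramids `convexHull ((E \ {v}) ∪ {p})` over its facets with apex
`p`. -/
theorem convexHull_eq_union_stellar_pyramids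
    (N : ℕ) (E : Set (Fin N → ℝ)) (hfin : E.Finite) (hne : E.Nonempty)
    (hind : AffineIndependent ℝ ((↑) : E → (Fin N → ℝ)))
    (p : Fin N → ℝ) (hp : p ∈ convexHull ℝ E) :
    convexHull ℝ E = ⋃ v ∈ E, convexHull ℝ ((E \ {v}) ∪ {p}) := by
  apply Subset.antisymm
  · intro x hx
    lift E to Finset (Fin N → ℝ) using hfin
    simpa using Finset.exists_mem_convexHull_diff_union_singleton hp hx
  · exact iUnion₂_subset fun v _ => convexHull_min
      (union_subset (sdiff_subset.trans (subset_convexHull ℝ E)) (singleton_subset_iff.2 hp))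
      (convex_convexHull ℝ E)
end
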